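/- arXiv:2301.10226 — 6 statements merged into one kernel-verified Lean document; each statement's English description precedes it below -/
import Mathlib

section
/- For any integer N ≥ 1, any probability vector p ∈ ℝ^N (entries nonnegative, summing to 1), and any scalar z > 0, the spike entropy satisfies S(p,z) ≤ N/(N+z), with equality when p is the uniform distribution p_k = 1/N for all k. -/
open scoped BigOperators

/-- The spike entropy of a probability vector `p` with modulus `z`:
`S(p,z) = ∑ k, p k / (1 + z * p k)`. -/
noncomputable def spikeEntropy {N : ℕ} (p : Fin N → ℝ) (z : ℝ) : ℝ :=
  ∑ k, p k / (1 + z * p k)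

/-- The tangent line to the concave function `x ↦ x / (1 + z * x)` at `x = 1 / n` lies above its
graph. -/
theorem div_one_add_mul_le_tangent {n z x : ℝ} (hn : 0 < n) (hz : 0 ≤ z) (hx : 0 ≤ x) :
    x / (1 + z * x) ≤ (n ^ 2 * x + z) / (n + z) ^ 2 := by
  rw [div_le_div_iff₀ (by positivity) (by positivity)]
  linarith [mul_nonneg hz (sq_nonneg (1 - n * x))]

/-- For any probability vector `p ∈ ℝ^N` and any `z > 0`, the spike entropy satisfies
`S(p,z) ≤ N/(N+z)`, with equality when `p` is the uniform distribution. -/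
theorem spikeEntropy_le_uniform (N : ℕ) (hN : 1 ≤ N) (p : Fin N → ℝ)
    (hp0 : ∀ k, 0 ≤ p k) (hp1 : ∑ k, p k = 1) (z : ℝ) (hz : 0 < z) :
    spikeEntropy p z ≤ N / (N + z) ∧
      ((∀ k, p k = 1 / N) → spikeEntropy p z = N / (N + z)) := by
  have hn : (0 : ℝ) < N := by exact_mod_cast hN
  refine ⟨?_, fun h => ?_⟩
  · calc spikeEntropy p z ≤ ∑ k, ((N : ℝ) ^ 2 * p k + z) / ((N : ℝ) + z) ^ 2 :=
          Finset.sum_le_sum fun k _ => div_one_add_mul_le_tangent hn hz.le (hp0 k)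
      _ = N / (N + z) := by
          rw [← Finset.sum_div, Finset.sum_add_distrib, ← Finset.mul_sum, hp1]
          simp only [Finset.sum_const, Finset.card_univ, Fintype.card_fin, nsmul_eq_mul]
          field_simp
  · simp only [spikeEntropy, h, Finset.sum_const, Finset.card_univ, Fintype.card_fin,
      nsmul_eq_mul]
    field_simp
end

section
/- Suppose a language model produces a raw probability vector p ∈ (0,1)^N with Σ_k p_k = 1. Let γ ∈ (0,1) with γN an integer, let δ > 0 and α = exp(δ). Choose a green list G uniformly at random among subsets of {1,…,N} of size γN, with complement R, form the watermarked distribution p̂, and sample a token index k from p̂. Then the probability (over the random partition and the sampling) that the sampled token lies in the green list satisfies P[k ∈ G] ≥ (γα/(1+(α-1)γ)) · S(p, (1-γ)(α-1)/(1+(α-1)γ)). -/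
open scoped BigOperators

open Finset in
/-- Among the `m`-subsets of an `N`-element type, a fraction `m / N` contains a given element. -/
theorem card_filter_mem_powersetCard_univ {N m : ℕ} (hm : 1 ≤ m) (k : Fin N) :
    N * #{G ∈ powersetCard m (univ : Finset (Fin N)) | k ∈ G} =
      m * #(powersetCard m (univ : Finset (Fin N))) := by
  have h := card_filter_powersetCard_subset {k} (univ : Finset (Fin N)) m (subset_univ _)
    (by simpa using hm)
  simp only [singleton_subset_iff, card_univ, Fintype.card_fin, card_singleton] at h
  rw [h, card_powersetCard, card_univ, Fintype.card_fin]
  obtain ⟨n, rfl⟩ : ∃ n, N = n + 1 := ⟨N - 1, by have := k.pos; lia⟩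
  obtain ⟨j, rfl⟩ : ∃ j, m = j + 1 := ⟨m - 1, by lia⟩
  have := Nat.add_one_mul_choose_eq n j
  simp only [Nat.add_sub_cancel]
  linarith

open Finset in
/-- Among the `m`-subsets containing `k`, a fraction at most `m / N` contains another given
element. -/
theorem card_filter_mem_mem_powersetCard_univ_le {N m : ℕ} (hm : 1 ≤ m) (hmN : m ≤ N)
    {i k : Fin N} (hik : i ≠ k) :
    N * #{G ∈ powersetCard m (univ : Finset (Fin N)) | k ∈ G ∧ i ∈ G} ≤
      m * #{G ∈ powersetCard m (univ : Finset (Fin N)) | k ∈ G} := by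
  rcases hm.eq_or_lt with rfl | hm2
  · have : #{G ∈ powersetCard 1 (univ : Finset (Fin N)) | k ∈ G ∧ i ∈ G} = 0 := by
      rw [card_eq_zero, filter_eq_empty_iff]
      rintro G hG ⟨hk, hi⟩
      exact hik (card_le_one.mp (mem_powersetCard.mp hG).2.le i hi k hk)
    simp [this]
  have h1 := card_filter_powersetCard_subset {k} (univ : Finset (Fin N)) m (subset_univ _)
    (by simpa using hm)
  have h2 := card_filter_powersetCard_subset {k, i} (univ : Finset (Fin N)) m (subset_univ _)
    (by rw [card_pair hik.symm]; lia)
  simp only [insert_subset_iff, singleton_subset_iff, card_univ, Fintype.card_fin,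
    card_singleton, card_pair hik.symm] at h1 h2
  rw [h1, h2]
  obtain ⟨n, rfl⟩ : ∃ n, N = n + 2 := ⟨N - 2, by lia⟩
  obtain ⟨j, rfl⟩ : ∃ j, m = j + 2 := ⟨m - 2, by lia⟩
  have h := Nat.add_one_mul_choose_eq n j
  have e1 : n + 2 - 1 = n + 1 := rfl
  have e2 : j + 2 - 1 = j + 1 := rfl
  rw [e1, e2, Nat.add_sub_cancel, Nat.add_sub_cancel]
  refine Nat.le_of_mul_le_mul_left (c := n + 1) ?_ n.succ_pos
  calc (n + 1) * ((n + 2) * n.choose j) = (n + 2) * ((n + 1) * n.choose j) := by ring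
    _ = ((n + 2) * (j + 1)) * (n + 1).choose (j + 1) := by rw [h]; ring
    _ ≤ ((n + 1) * (j + 2)) * (n + 1).choose (j + 1) := by
        refine Nat.mul_le_mul_right _ ?_
        linarith
    _ = (n + 1) * ((j + 2) * (n + 1).choose (j + 1)) := by ring

/-- The harmonic-arithmetic mean inequality: if positive numbers have mean at most `c`, their
reciprocals have mean at least `1 / c`. -/
theorem card_div_le_sum_inv {ι : Type*} (s : Finset ι) (D : ι → ℝ) {c : ℝ} (hc : 0 < c)
    (hD : ∀ G ∈ s, 0 < D G) (h : ∑ G ∈ s, D G ≤ s.card * c) :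
    s.card / c ≤ ∑ G ∈ s, (D G)⁻¹ := by
  have tangent : ∀ G ∈ s, 2 / c - D G / c ^ 2 ≤ (D G)⁻¹ := fun G hG => by
    have := hD G hG
    have e : (D G)⁻¹ - (2 / c - D G / c ^ 2) = (D G - c) ^ 2 / (D G * c ^ 2) := by
      field_simp
      ring
    have : 0 ≤ (D G - c) ^ 2 / (D G * c ^ 2) := by positivity
    linarith
  calc (s.card : ℝ) / c = s.card * (2 / c) - s.card * c / c ^ 2 := by
        field_simp
        ring
    _ ≤ s.card * (2 / c) - (∑ G ∈ s, D G) / c ^ 2 := by gcongr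
    _ = ∑ G ∈ s, (2 / c - D G / c ^ 2) := by
        rw [Finset.sum_sub_distrib, Finset.sum_const, nsmul_eq_mul, Finset.sum_div]
    _ ≤ _ := Finset.sum_le_sum tangent

open Finset in
/-- The total mass, over green lists containing `k`, is at most what it would be if each other
token were green independently with probability `γ`. -/
theorem sum_filter_mem_sum_le {N : ℕ} (p : Fin N → ℝ) (hp : ∀ k, 0 ≤ p k)
    (hsum : ∑ k, p k = 1) {γ : ℝ} {m : ℕ} (hm : (m : ℝ) = γ * N) (hm1 : 1 ≤ m) (hmN : m ≤ N)
    (k : Fin N) :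
    ∑ G ∈ powersetCard m (univ : Finset (Fin N)) with k ∈ G, ∑ i ∈ G, p i ≤
      #{G ∈ powersetCard m (univ : Finset (Fin N)) | k ∈ G} * (p k + γ * (1 - p k)) := by
  have hN : (0 : ℝ) < N := by exact_mod_cast k.pos
  have swap : ∑ G ∈ powersetCard m (univ : Finset (Fin N)) with k ∈ G, ∑ i ∈ G, p i =
      ∑ i, #{G ∈ powersetCard m (univ : Finset (Fin N)) | k ∈ G ∧ i ∈ G} * p i := by
    rw [sum_comm' (t' := univ)
      (s' := fun i => {G ∈ powersetCard m (univ : Finset (Fin N)) | k ∈ G ∧ i ∈ G})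
      (by intro G i; simp [and_assoc])]
    simp
  have hrest : ∑ i ∈ univ.erase k, p i = 1 - p k := by
    rw [← hsum, ← add_sum_erase univ p (mem_univ k)]
    ring
  rw [swap, ← add_sum_erase _ _ (mem_univ k), mul_add, ← hrest]
  simp only [and_self]
  rw [mul_sum, mul_sum]
  refine add_le_add_right (sum_le_sum fun i hi => ?_) _
  rw [← mul_assoc]
  refine mul_le_mul_of_nonneg_right ?_ (hp i)
  have h := card_filter_mem_mem_powersetCard_univ_le hm1 hmN (ne_of_mem_erase hi)
  have h' : (N : ℝ) * #{G ∈ powersetCard m (univ : Finset (Fin N)) | k ∈ G ∧ i ∈ G} ≤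
      m * #{G ∈ powersetCard m (univ : Finset (Fin N)) | k ∈ G} := by
    exact_mod_cast h
  rw [hm] at h'
  refine le_of_mul_le_mul_left ?_ hN
  linarith

/-- Given a green list `G` of size `γN` chosen uniformly at random, the probability that a
token sampled from the watermarked distribution lies in the green list is at least
`(γα/(1+(α-1)γ)) · S(p, (1-γ)(α-1)/(1+(α-1)γ))`.  The probability on the left is the average,
over all green lists `G` of size `γN`, of the total watermarked mass of the green list
`∑_{k ∈ G} α p_k / (∑_{i ∈ R} p_i + α ∑_{i ∈ G} p_i)`. -/
theorem prob_sample_green_ge (N : ℕ) (p : Fin N → ℝ)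
    (hp : ∀ k, p k ∈ Set.Ioo (0 : ℝ) 1) (hsum : ∑ k, p k = 1)
    (γ : ℝ) (hγ : γ ∈ Set.Ioo (0 : ℝ) 1)
    (m : ℕ) (hm : (m : ℝ) = γ * N)
    (δ : ℝ) (hδ : 0 < δ) (α : ℝ) (hα : α = Real.exp δ) :
    γ * α / (1 + (α - 1) * γ) *
        spikeEntropy p ((1 - γ) * (α - 1) / (1 + (α - 1) * γ)) ≤
      (∑ G ∈ Finset.powersetCard m (Finset.univ : Finset (Fin N)),
          ∑ k ∈ G, α * p k / ((∑ i ∈ Gᶜ, p i) + α * ∑ i ∈ G, p i)) /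
        (Finset.powersetCard m (Finset.univ : Finset (Fin N))).card := by
  obtain ⟨hγ0, hγ1⟩ := hγ
  have hα1 : 1 < α := hα ▸ Real.one_lt_exp_iff.mpr hδ
  have hN : (0 : ℝ) < N := by
    rcases Nat.eq_zero_or_pos N with rfl | h
    · simp at hsum
    · exact_mod_cast h
  have hm1 : 1 ≤ m := by
    have : (0 : ℝ) < m := hm ▸ mul_pos hγ0 hN
    exact_mod_cast this
  have hmN : m ≤ N := by
    have : (m : ℝ) ≤ N := by nlinarith
    exact_mod_cast this
  set F := Finset.powersetCard m (Finset.univ : Finset (Fin N)) with hF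
  have hC : (0 : ℝ) < F.card := by
    rw [hF, Finset.card_powersetCard, Finset.card_univ, Fintype.card_fin]
    exact_mod_cast Nat.choose_pos hmN
  have hden : ∀ G : Finset (Fin N),
      (∑ i ∈ Gᶜ, p i) + α * ∑ i ∈ G, p i = 1 + (α - 1) * ∑ i ∈ G, p i := fun G => by
    have := Finset.sum_compl_add_sum G p
    linarith
  have ha : 0 < 1 + (α - 1) * γ := by nlinarith
  have hswap : ∑ G ∈ F, ∑ k ∈ G, α * p k / ((∑ i ∈ Gᶜ, p i) + α * ∑ i ∈ G, p i) =
      ∑ k, ∑ G ∈ F with k ∈ G, α * p k * (1 + (α - 1) * ∑ i ∈ G, p i)⁻¹ := by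
    simp only [hden, div_eq_mul_inv]
    exact Finset.sum_comm' (by intro G k; simp)
  rw [hswap, le_div_iff₀ hC, spikeEntropy, Finset.mul_sum, Finset.sum_mul]
  refine Finset.sum_le_sum fun k _ => ?_
  have hpk : 0 < p k := (hp k).1
  have hA : ((F.filter (k ∈ ·)).card : ℝ) = γ * F.card := by
    have h : (N : ℝ) * (F.filter (k ∈ ·)).card = m * F.card := by
      exact_mod_cast card_filter_mem_powersetCard_univ hm1 k
    rw [hm] at h
    refine mul_left_cancel₀ hN.ne' ?_
    linarith
  set c := 1 + (α - 1) * (p k + γ * (1 - p k)) with hc_def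
  have hc : 0 < c := by
    have : 0 ≤ (α - 1) * (p k + γ * (1 - p k)) :=
      mul_nonneg (by linarith) (by nlinarith [(hp k).2])
    linarith
  have hmean : ((F.filter (k ∈ ·)).card : ℝ) / c ≤
      ∑ G ∈ F with k ∈ G, (1 + (α - 1) * ∑ i ∈ G, p i)⁻¹ := by
    refine card_div_le_sum_inv _ _ hc (fun G _ => ?_) ?_
    · have : 0 ≤ ∑ i ∈ G, p i := Finset.sum_nonneg fun i _ => (hp i).1.le
      nlinarith
    · have h := sum_filter_mem_sum_le p (fun i => (hp i).1.le) hsum hm hm1 hmN k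
      rw [Finset.sum_add_distrib, ← Finset.mul_sum, Finset.sum_const, nsmul_eq_mul, mul_one]
      have := mul_le_mul_of_nonneg_left h (sub_nonneg.mpr hα1.le)
      rw [hc_def]
      linarith
  have hterm : γ * α / (1 + (α - 1) * γ) *
      (p k / (1 + (1 - γ) * (α - 1) / (1 + (α - 1) * γ) * p k)) = α * p k * (γ / c) := by
    have : 1 + (1 - γ) * (α - 1) / (1 + (α - 1) * γ) * p k = c / (1 + (α - 1) * γ) := by
      rw [hc_def, eq_div_iff ha.ne', add_mul, mul_right_comm, div_mul_cancel₀ _ ha.ne']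
      ring
    rw [this, div_div_eq_mul_div, mul_div_assoc', mul_comm (p k), ← mul_assoc,
      div_mul_cancel₀ _ ha.ne']
    ring
  rw [← Finset.mul_sum, hterm, mul_assoc, div_mul_eq_mul_div, ← hA]
  have : 0 < α := by linarith
  gcongr
end

section
/- Let p ∈ (0,1)^N be a probability vector with Σ_i p_i = 1, fix an index k, let α ≥ 1, γ ∈ (0,1) with N_G = γN an integer, and take the expectation over partitions of {1,…,N} into a green list G of size N_G containing k and red list R = G^c chosen uniformly at random among such partitions. Then E_{G,R : k∈G}[ α p_k / (Σ_{i∈R} p_i + α Σ_{i∈G} p_i) ] ≥ α p_k / (1 + (α-1)γ + (α-1)(1-γ)p_k). -/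
open scoped BigOperators

/-- Among the `m`-subsets of `t` that contain `k`, at most a fraction `m / #t` contains a given
further element `i`. -/
theorem card_mul_card_powersetCard_filter_pair_le {ι : Type*} [DecidableEq ι] {t : Finset ι}
    {i k : ι} (hi : i ∈ t) (hk : k ∈ t) (hik : i ≠ k) (m : ℕ) :
    t.card * (((t.powersetCard m).filter (fun G => k ∈ G)).filter (fun G => i ∈ G)).card ≤
      m * ((t.powersetCard m).filter (fun G => k ∈ G)).card := by
  have hpair : ({i, k} : Finset ι).card = 2 := Finset.card_pair hik
  have hsub : ({i, k} : Finset ι) ⊆ t := by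
    simp [Finset.insert_subset_iff, hi, hk]
  have hfilter : ((t.powersetCard m).filter (fun G => k ∈ G)).filter (fun G => i ∈ G) =
      (t.powersetCard m).filter (({i, k} : Finset ι) ⊆ ·) := by
    ext G
    simp only [Finset.mem_filter, Finset.insert_subset_iff, Finset.singleton_subset_iff]
    tauto
  rcases Nat.lt_or_ge m 2 with hm | hm
  · have hempty : (t.powersetCard m).filter (({i, k} : Finset ι) ⊆ ·) = ∅ := by
      refine Finset.filter_false_of_mem fun G hG hG' => ?_
      have hcard := Finset.card_le_card hG'
      rw [hpair, (Finset.mem_powersetCard.1 hG).2] at hcard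
      omega
    simp [hfilter, hempty]
  · have hsingle := Finset.card_filter_powersetCard_subset {k} t m
      (Finset.singleton_subset_iff.2 hk) (by simp; omega)
    simp only [Finset.singleton_subset_iff, Finset.card_singleton] at hsingle
    rw [hfilter, Finset.card_filter_powersetCard_subset _ t m hsub (hpair ▸ hm), hpair, hsingle]
    obtain ⟨r, rfl⟩ := Nat.exists_eq_add_of_le' hm
    obtain ⟨n, hn⟩ := Nat.exists_eq_add_of_le' (hpair ▸ Finset.card_le_card hsub)
    rw [hn]
    simp only [Nat.add_sub_cancel, Nat.add_succ_sub_one]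
    nlinarith [Nat.add_one_mul_choose_eq n r, Nat.choose_succ_succ n r]

/-- The average weight of an `m`-subset of `t` containing `k` is at most the weight of `k` plus
`m / #t` times the weight of `t \ {k}`. -/
theorem card_mul_sum_powersetCard_filter_le {ι : Type*} [DecidableEq ι] {t : Finset ι}
    {k : ι} (hk : k ∈ t) (m : ℕ) {p : ι → ℝ} (hp : ∀ i ∈ t, 0 ≤ p i) :
    t.card * ∑ G ∈ (t.powersetCard m).filter (fun G => k ∈ G), ∑ i ∈ G, p i ≤
      ((t.powersetCard m).filter (fun G => k ∈ G)).card *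
        (t.card * p k + m * ∑ i ∈ t.erase k, p i) := by
  set F := (t.powersetCard m).filter (fun G => k ∈ G)
  have hswap : ∑ G ∈ F, ∑ i ∈ G, p i = ∑ i ∈ t, (F.filter (fun G => i ∈ G)).card * p i := by
    rw [Finset.sum_comm' (t' := t) (s' := fun i => F.filter (fun G => i ∈ G))]
    · simp
    · intro G i
      simp only [Finset.mem_filter, F, Finset.mem_powersetCard]
      exact ⟨fun h => ⟨⟨h.1, h.2⟩, h.1.1.1 h.2⟩, fun h => h.1⟩
  have hself : F.filter (fun G => k ∈ G) = F :=
    Finset.filter_true_of_mem fun G hG => (Finset.mem_filter.1 hG).2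
  have hrest : ∑ i ∈ t.erase k, (t.card : ℝ) * ((F.filter (fun G => i ∈ G)).card * p i) ≤
      ∑ i ∈ t.erase k, (m * F.card : ℝ) * p i := by
    refine Finset.sum_le_sum fun i hi => ?_
    obtain ⟨hik, hit⟩ := Finset.mem_erase.1 hi
    rw [← mul_assoc]
    refine mul_le_mul_of_nonneg_right ?_ (hp i hit)
    exact_mod_cast card_mul_card_powersetCard_filter_pair_le hit hk hik m
  rw [← Finset.mul_sum, ← Finset.mul_sum] at hrest
  rw [hswap, ← Finset.add_sum_erase _ _ hk, hself]
  linarith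

/-- Jensen's inequality for `x ↦ c / x` under the uniform distribution on a finite set, with an
upper bound in place of the mean. -/
theorem div_le_sum_div_div_card {ι : Type*} {s : Finset ι} (hs : s.Nonempty) {f : ι → ℝ}
    (hf : ∀ i ∈ s, 0 < f i) {b c : ℝ} (hb : 0 < b) (hc : 0 ≤ c)
    (hmean : ∑ i ∈ s, f i ≤ s.card * b) : c / b ≤ (∑ i ∈ s, c / f i) / s.card := by
  have hcard : (0 : ℝ) < s.card := by exact_mod_cast hs.card_pos
  have htangent : ∀ i ∈ s, c / b ^ 2 * (2 * b - f i) ≤ c / f i := by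
    intro i hi
    have hfi := hf i hi
    rw [div_mul_eq_mul_div, div_le_div_iff₀ (by positivity) hfi]
    nlinarith [mul_nonneg hc (sq_nonneg (b - f i))]
  have hsum := Finset.sum_le_sum htangent
  rw [← Finset.mul_sum, Finset.sum_sub_distrib, Finset.sum_const, nsmul_eq_mul] at hsum
  rw [le_div_iff₀ hcard]
  refine le_trans ?_ hsum
  calc c / b * s.card = c / b ^ 2 * (s.card * b) := by field_simp
    _ ≤ _ := mul_le_mul_of_nonneg_left (by linarith) (by positivity)

/-- For a probability vector `p ∈ (0,1)^N`, a fixed index `k`, `α ≥ 1` and green list size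
`N_G = γN`, the expectation over uniformly random partitions into a green list `G` of size
`γN` containing `k` and red list `R = Gᶜ` satisfies
`E_{G,R : k∈G}[ α p_k / (∑_{i∈R} p_i + α ∑_{i∈G} p_i) ] ≥
  α p_k / (1 + (α-1)γ + (α-1)(1-γ) p_k)`. -/
theorem expected_green_token_prob_ge (N : ℕ) (p : Fin N → ℝ)
    (hp : ∀ i, p i ∈ Set.Ioo (0 : ℝ) 1) (hsum : ∑ i, p i = 1)
    (k : Fin N) (α : ℝ) (hα : 1 ≤ α)
    (γ : ℝ) (hγ : γ ∈ Set.Ioo (0 : ℝ) 1) (m : ℕ) (hm : (m : ℝ) = γ * N) :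
    α * p k / (1 + (α - 1) * γ + (α - 1) * (1 - γ) * p k) ≤
      (∑ G ∈ (Finset.powersetCard m (Finset.univ : Finset (Fin N))).filter
          (fun G => k ∈ G),
          α * p k / ((∑ i ∈ Gᶜ, p i) + α * ∑ i ∈ G, p i)) /
        ((Finset.powersetCard m (Finset.univ : Finset (Fin N))).filter
          (fun G => k ∈ G)).card := by
  obtain ⟨hγ0, hγ1⟩ := hγ
  have hpk := (hp k).1
  have hN : 0 < N := k.pos
  have hNR : (0 : ℝ) < N := by exact_mod_cast hN
  have hm0 : 1 ≤ m := by
    have : (0 : ℝ) < m := hm ▸ mul_pos hγ0 hNR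
    exact_mod_cast this
  have hmN : m ≤ N := by
    have : (m : ℝ) ≤ N := by nlinarith
    exact_mod_cast this
  have hα' : 0 ≤ α - 1 := by linarith
  have hden : ∀ G : Finset (Fin N),
      (∑ i ∈ Gᶜ, p i) + α * ∑ i ∈ G, p i = 1 + (α - 1) * ∑ i ∈ G, p i := by
    intro G
    linarith [Finset.sum_add_sum_compl G p]
  simp only [hden]
  have herase : ∑ i ∈ Finset.univ.erase k, p i = 1 - p k := by
    linarith [Finset.add_sum_erase Finset.univ p (Finset.mem_univ k)]
  refine div_le_sum_div_div_card ?_ ?_ ?_ (by positivity) ?_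
  · obtain ⟨G, hkG, -, hG⟩ := Finset.exists_subsuperset_card_eq
      (Finset.subset_univ {k}) (by simpa using hm0) (by simpa using hmN)
    exact ⟨G, by simpa [hG] using hkG⟩
  · intro G _
    have : 0 ≤ ∑ i ∈ G, p i := Finset.sum_nonneg fun i _ => (hp i).1.le
    positivity
  · have : 0 ≤ 1 - γ := by linarith
    positivity
  · have hmean := card_mul_sum_powersetCard_filter_le (Finset.mem_univ k) m
      (fun i _ => (hp i).1.le)
    rw [herase, hm, Finset.card_univ, Fintype.card_fin] at hmean
    rw [Finset.sum_add_distrib, ← Finset.mul_sum, Finset.sum_const, nsmul_eq_mul]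
    set F := (Finset.powersetCard m (Finset.univ : Finset (Fin N))).filter (fun G => k ∈ G)
    have hweight : ∑ G ∈ F, ∑ i ∈ G, p i ≤ F.card * (p k + γ * (1 - p k)) :=
      le_of_mul_le_mul_left (by linarith) hNR
    linarith [mul_le_mul_of_nonneg_left hweight hα']
end

section
/- Let p ∈ (0,1)^N be a probability vector with Σ_k p_k = 1, let γ ∈ (0,1) with γN an integer, let δ > 0 and α = exp(δ), and let G be a uniformly random subset of {1,…,N} of size γN with complement R, defining the watermarked distribution p̂. Then the expected cross-entropy of the watermarked distribution with respect to the original model satisfies E_{G,R}[ Σ_k p̂_k · (−ln p_k) ] ≤ (1 + (α-1)γ) · Σ_k p_k · (−ln p_k); that is, the expected perplexity term is at most (1+(α-1)γ) times P★ = Σ_k p_k (−ln p_k), the corresponding quantity for the original model. -/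
open scoped BigOperators

/-- Double counting of the incidences between elements of a finite type and its `m`-subsets
containing them. -/
theorem Finset.card_mul_card_filter_mem_powersetCard_univ {ι : Type*} [Fintype ι]
    [DecidableEq ι] (m : ℕ) (k : ι) :
    Fintype.card ι * ((Finset.powersetCard m (Finset.univ : Finset ι)).filter (k ∈ ·)).card =
      m * (Finset.powersetCard m (Finset.univ : Finset ι)).card := by
  have hfilter : (Finset.powersetCard m (Finset.univ : Finset ι)).filter (k ∈ ·) =
      (Finset.powersetCard m Finset.univ).filter ({k} ⊆ ·) := by
    simp
  rcases m with _ | m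
  · simp [Finset.filter_singleton]
  · obtain ⟨n, hn⟩ : ∃ n, Fintype.card ι = n + 1 :=
      Nat.exists_eq_succ_of_ne_zero (Fintype.card_pos_iff.2 ⟨k⟩).ne'
    rw [hfilter, Finset.card_filter_powersetCard_subset _ _ _ (by simp) (by simp)]
    simp only [Finset.card_powersetCard, Finset.card_univ, Finset.card_singleton, hn,
      Nat.add_sub_cancel]
    rw [Nat.add_one_mul_choose_eq, mul_comm]

/-- Tilting a probability vector by `a ≥ 1` on `G` does not decrease its total mass. -/
theorem one_le_sum_compl_add_mul_sum {ι : Type*} [Fintype ι] [DecidableEq ι] {p : ι → ℝ}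
    (hp : ∀ i, 0 ≤ p i) (hsum : ∑ i, p i = 1) {a : ℝ} (ha : 1 ≤ a) (G : Finset ι) :
    1 ≤ (∑ i ∈ Gᶜ, p i) + a * ∑ i ∈ G, p i := by
  have hG : 0 ≤ ∑ i ∈ G, p i := Finset.sum_nonneg fun i _ => hp i
  have := Finset.sum_add_sum_compl G p
  nlinarith

/-- Let `p ∈ (0,1)^N` be a probability vector, `γ ∈ (0,1)` with `γN` an integer, `δ > 0`,
`α = exp δ`, and let `G` be a uniformly random green list of size `γN` with complement `R`,
defining the watermarked distribution `p̂`.  Then the expected cross-entropy of `p̂` with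
respect to the original model satisfies
`E_{G,R}[ ∑_k p̂_k · (−ln p_k) ] ≤ (1+(α-1)γ) · ∑_k p_k · (−ln p_k)`. -/
theorem expected_perplexity_le (N : ℕ) (p : Fin N → ℝ)
    (hp : ∀ i, p i ∈ Set.Ioo (0 : ℝ) 1) (hsum : ∑ i, p i = 1)
    (γ : ℝ) (hγ : γ ∈ Set.Ioo (0 : ℝ) 1) (m : ℕ) (hm : (m : ℝ) = γ * N)
    (δ : ℝ) (hδ : 0 < δ) (α : ℝ) (hα : α = Real.exp δ) :
    (∑ G ∈ Finset.powersetCard m (Finset.univ : Finset (Fin N)),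
        ∑ k, (if k ∈ G then α * p k else p k) /
            ((∑ i ∈ Gᶜ, p i) + α * ∑ i ∈ G, p i) * (-Real.log (p k))) /
        (Finset.powersetCard m (Finset.univ : Finset (Fin N))).card ≤
      (1 + (α - 1) * γ) * ∑ k, p k * (-Real.log (p k)) := by
  have hα1 : 1 ≤ α := hα ▸ Real.one_le_exp hδ.le
  have hN : N ≠ 0 := by
    rintro rfl
    simp at hsum
  have hN0 : (0 : ℝ) < N := by positivity
  set S := Finset.powersetCard m (Finset.univ : Finset (Fin N))
  have hmN : m ≤ N := by
    have : (m : ℝ) ≤ N := by nlinarith [hγ.2]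
    exact_mod_cast this
  have hScard : (0 : ℝ) < S.card := by
    exact_mod_cast Finset.card_pos.2 (Finset.powersetCard_nonempty.2 (by simpa using hmN))
  have hcount (k : Fin N) : ((S.filter (k ∈ ·)).card : ℝ) = γ * S.card := by
    have h := Finset.card_mul_card_filter_mem_powersetCard_univ m k
    rw [Fintype.card_fin] at h
    have h' : (N : ℝ) * (S.filter (k ∈ ·)).card = m * S.card := by exact_mod_cast h
    rw [hm] at h'
    exact mul_left_cancel₀ hN0.ne' (by linarith)
  have hlog (k : Fin N) : 0 ≤ -Real.log (p k) :=
    neg_nonneg.2 (Real.log_nonpos (hp k).1.le (hp k).2.le)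
  rw [div_le_iff₀ hScard]
  calc
    _ ≤ ∑ G ∈ S, ∑ k, (if k ∈ G then α * p k else p k) * (-Real.log (p k)) := by
      refine Finset.sum_le_sum fun G _ => Finset.sum_le_sum fun k _ => ?_
      refine mul_le_mul_of_nonneg_right (div_le_self ?_ ?_) (hlog k)
      · have := (hp k).1.le
        split_ifs <;> positivity
      · exact one_le_sum_compl_add_mul_sum (fun i => (hp i).1.le) hsum hα1 G
    _ = ∑ k, ∑ G ∈ S, (p k + if k ∈ G then (α - 1) * p k else 0) * (-Real.log (p k)) := by
      rw [Finset.sum_comm]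
      refine Finset.sum_congr rfl fun k _ => Finset.sum_congr rfl fun G _ => ?_
      split_ifs <;> ring
    _ = (1 + (α - 1) * γ) * (∑ k, p k * (-Real.log (p k))) * S.card := by
      rw [Finset.mul_sum, Finset.sum_mul]
      refine Finset.sum_congr rfl fun k _ => ?_
      rw [← Finset.sum_mul, Finset.sum_add_distrib, ← Finset.sum_filter, Finset.sum_const,
        Finset.sum_const, nsmul_eq_mul, nsmul_eq_mul, hcount]
      ring
end

section
/- Let p ∈ (0,1)^N be a probability vector with Σ_k p_k = 1, let γ ∈ (0,1) with γN an integer, let α ≥ 1, and let G be a uniformly random subset of {1,…,N} of size γN with complement R, defining the watermarked distribution p̂. Then for every index k, the expected watermarked probability satisfies E_{G,R}[ p̂_k ] ≤ (1 + (α-1)γ) · p_k. -/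
open scoped BigOperators

/-- Among the `m`-element subsets of a type with `N` elements, the fraction avoiding a fixed
element is `(N - m) / N`. -/
theorem card_filter_notMem_powersetCard_univ_mul {N : ℕ} (m : ℕ) (hm : m ≤ N) (k : Fin N) :
    (((Finset.powersetCard m (Finset.univ : Finset (Fin N))).filter (k ∉ ·)).card : ℝ) * N =
      (Finset.powersetCard m (Finset.univ : Finset (Fin N))).card * ((N : ℝ) - m) := by
  have h : (Finset.powersetCard m (Finset.univ : Finset (Fin N))).filter (k ∉ ·) =
      Finset.powersetCard m (Finset.univ.erase k) := by
    ext G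
    simp only [Finset.mem_filter, Finset.mem_powersetCard, Finset.subset_univ, true_and,
      Finset.subset_erase]
    tauto
  cases N with
  | zero => exact k.elim0
  | succ n =>
    rw [h, Finset.card_powersetCard, Finset.card_powersetCard,
      Finset.card_erase_of_mem (Finset.mem_univ k), Finset.card_fin, Nat.add_sub_cancel,
      ← Nat.cast_sub hm]
    exact_mod_cast Nat.choose_mul_succ_eq n m

/-- Let `p ∈ (0,1)^N` be a probability vector, `γ ∈ (0,1)` with `γN` an integer, `α ≥ 1`,
and let `G` be a uniformly random green list of size `γN` with complement `R`, defining the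
watermarked distribution `p̂`.  Then for every index `k`, the expected watermarked
probability satisfies `E_{G,R}[ p̂_k ] ≤ (1+(α-1)γ) · p_k`. -/
theorem expected_watermarked_prob_le (N : ℕ) (p : Fin N → ℝ)
    (hp : ∀ i, p i ∈ Set.Ioo (0 : ℝ) 1) (hsum : ∑ i, p i = 1)
    (γ : ℝ) (hγ : γ ∈ Set.Ioo (0 : ℝ) 1) (m : ℕ) (hm : (m : ℝ) = γ * N)
    (α : ℝ) (hα : 1 ≤ α) (k : Fin N) :
    (∑ G ∈ Finset.powersetCard m (Finset.univ : Finset (Fin N)),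
        (if k ∈ G then α * p k else p k) /
          ((∑ i ∈ Gᶜ, p i) + α * ∑ i ∈ G, p i)) /
        (Finset.powersetCard m (Finset.univ : Finset (Fin N))).card ≤
      (1 + (α - 1) * γ) * p k := by
  have hN : (0 : ℝ) < N := by exact_mod_cast k.pos
  have hmN : m ≤ N := by
    have : (m : ℝ) ≤ N := by nlinarith [hγ.2]
    exact_mod_cast this
  set S := Finset.powersetCard m (Finset.univ : Finset (Fin N)) with hS
  have hpk : 0 < p k := (hp k).1
  have hcard : (0 : ℝ) < S.card := by
    rw [hS, Finset.card_powersetCard, Finset.card_fin]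
    exact_mod_cast Nat.choose_pos hmN
  have hcount : ((S.filter (k ∉ ·)).card : ℝ) = S.card * (1 - γ) := by
    have := card_filter_notMem_powersetCard_univ_mul m hmN k
    rw [hm] at this
    exact mul_right_cancel₀ hN.ne' (this.trans (by ring))
  have hterm (G : Finset (Fin N)) :
      (if k ∈ G then α * p k else p k) / ((∑ i ∈ Gᶜ, p i) + α * ∑ i ∈ G, p i) ≤
        α * p k - if k ∉ G then (α - 1) * p k else 0 := by
    have hG : 0 ≤ ∑ i ∈ G, p i := Finset.sum_nonneg fun i _ => (hp i).1.le
    have hden : 1 ≤ (∑ i ∈ Gᶜ, p i) + α * ∑ i ∈ G, p i := by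
      have := Finset.sum_compl_add_sum G p
      nlinarith
    refine (div_le_self ?_ hden).trans_eq ?_
    · split_ifs <;> positivity
    · split_ifs <;> ring
  rw [div_le_iff₀ hcard]
  refine (Finset.sum_le_sum fun G _ => hterm G).trans_eq ?_
  rw [Finset.sum_sub_distrib, ← Finset.sum_filter, Finset.sum_const, Finset.sum_const,
    nsmul_eq_mul, nsmul_eq_mul, hcount]
  ring
end

section
/- Let V be a finite vocabulary and let green : V → Finset V be any function assigning to each token a green list (so that the green list for the token at position t is determined by the token at position t−1). For a sequence s : {0,…,T−1} → V, define the green count c(s) = #{t ∈ {1,…,T−1} : s(t) ∈ green(s(t−1))}. If two sequences s and s' of length T differ in at most n positions, then |c(s) − c(s')| ≤ 2n; in particular, modifying n tokens of a watermarked sequence can decrease the number of green list tokens by at most 2n. -/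
open scoped BigOperators

/-- One-sided comparison: passing from `s'` to `s` adds at most two green positions for each
position at which the sequences differ. -/
theorem green_count_le_add_two_mul_card_diff {V : Type*} [DecidableEq V]
    (green : V → Finset V) (T : ℕ) (s s' : ℕ → V) :
    ((Finset.Ico 1 T).filter (fun t => s t ∈ green (s (t - 1)))).card ≤
      ((Finset.Ico 1 T).filter (fun t => s' t ∈ green (s' (t - 1)))).card +
        2 * ((Finset.range T).filter (fun t => s t ≠ s' t)).card := by
  set D := (Finset.range T).filter (fun t => s t ≠ s' t)
  have hsub : (Finset.Ico 1 T).filter (fun t => s t ∈ green (s (t - 1))) ⊆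
      (Finset.Ico 1 T).filter (fun t => s' t ∈ green (s' (t - 1))) ∪
        (D ∪ D.image (· + 1)) := by
    intro t ht
    obtain ⟨hIco, hgreen⟩ := Finset.mem_filter.mp ht
    obtain ⟨h1, hT⟩ := Finset.mem_Ico.mp hIco
    by_cases hcur : s t = s' t
    · by_cases hprev : s (t - 1) = s' (t - 1)
      · refine Finset.mem_union_left _ (Finset.mem_filter.mpr ⟨hIco, ?_⟩)
        rwa [← hcur, ← hprev]
      · refine Finset.mem_union_right _ (Finset.mem_union_right _ ?_)
        refine Finset.mem_image.mpr ⟨t - 1, ?_, by omega⟩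
        exact Finset.mem_filter.mpr ⟨Finset.mem_range.mpr (by omega), hprev⟩
    · refine Finset.mem_union_right _ (Finset.mem_union_left _ ?_)
      exact Finset.mem_filter.mpr ⟨Finset.mem_range.mpr hT, hcur⟩
  have hcard := Finset.card_le_card hsub
  have hunion := Finset.card_union_le
    ((Finset.Ico 1 T).filter (fun t => s' t ∈ green (s' (t - 1)))) (D ∪ D.image (· + 1))
  have hD_union := Finset.card_union_le D (D.image (· + 1))
  have himage : (D.image (· + 1)).card ≤ D.card := Finset.card_image_le
  omega

/-- Let `V` be a finite vocabulary and `green : V → Finset V` a function assigning to each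
token the green list for the next position.  For a sequence `s`, the green count over
positions `1, …, T-1` is `c(s) = #{t ∈ [1,T) : s t ∈ green (s (t-1))}`.  If two sequences
differ in at most `n` of the positions `0, …, T-1`, then `|c(s) − c(s')| ≤ 2n`. -/
theorem green_count_diff_le (V : Type*) [Fintype V] [DecidableEq V]
    (green : V → Finset V) (T n : ℕ) (s s' : ℕ → V)
    (hdiff : ((Finset.range T).filter (fun t => s t ≠ s' t)).card ≤ n) :
    |(((Finset.Ico 1 T).filter (fun t => s t ∈ green (s (t - 1)))).card : ℤ) -
        (((Finset.Ico 1 T).filter (fun t => s' t ∈ green (s' (t - 1)))).card : ℤ)| ≤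
      2 * n := by
  have h := green_count_le_add_two_mul_card_diff green T s s'
  have h' := green_count_le_add_two_mul_card_diff green T s' s
  simp only [ne_comm (a := s' _)] at h'
  rw [abs_le]
  constructor <;> omega
end
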